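/- Let 𝒞 be a Cartan scheme with a root system ℛ of type 𝒞. Let X, Y ∈ 𝒳, let w ∈ Hom(Y,X), and let (i_1,…,i_m) be a reduced expression of w. Then the elements β_1,…,β_m are pairwise distinct elements of Δ^X_+ and {β_1,…,β_m} = R_w. Consequently |R_w| = ℓ(w), and the set {β_1,…,β_m} does not depend on the chosen reduced expression of w. -/

import Mathlib

noncomputable section

open scoped BigOperators

namespace WeylGpd

/-- A Cartan scheme: objects `X`, reflection maps `r_i`, and generalized Cartan matrices `A^X`
with `a^{r_i(X)}_{ij} = a^X_{ij}`. -/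
structure CartanScheme (n : ℕ) where
  X : Type
  nonempty : Nonempty X
  r : Fin n → X → X
  r_invol : ∀ i x, r i (r i x) = x
  A : X → Matrix (Fin n) (Fin n) ℤ
  A_diag : ∀ x i, A x i i = 2
  A_nonpos : ∀ x i j, i ≠ j → A x i j ≤ 0
  A_zero_iff : ∀ x i j, A x i j = 0 ↔ A x j i = 0
  A_r : ∀ x i j, A (r i x) i j = A x i j

variable {n : ℕ}

/-- The standard basis vector `α_i` of `ℤ^I`. -/
def alphav (n : ℕ) (i : Fin n) : Fin n → ℤ := Pi.single i 1

/-- The vectors with all coordinates nonnegative. -/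
def Epos (n : ℕ) : Set (Fin n → ℤ) := {v | ∀ i, 0 ≤ v i}

/-- The reflection `s_i^X`, `s_i^X(α_j) = α_j − a^X_{ij} α_i`, extended linearly. -/
def sMap (C : CartanScheme n) (i : Fin n) (x : C.X) (v : Fin n → ℤ) : Fin n → ℤ :=
  v - (∑ j, C.A x i j * v j) • alphav n i

/-- The endpoint `X_{m+1}` of a word `(i_1, …, i_m)` based at `x`. -/
def wordEnd (C : CartanScheme n) : C.X → List (Fin n) → C.X
  | x, [] => x
  | x, (i :: w) => wordEnd C (C.r i x) w

/-- The automorphism `s_{i_1}^{X_1} ∘ ⋯ ∘ s_{i_m}^{X_m}` of a word based at `x`. -/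
def wordMap (C : CartanScheme n) : C.X → List (Fin n) → (Fin n → ℤ) → (Fin n → ℤ)
  | _, [] => id
  | x, (i :: w) => sMap C i x ∘ wordMap C (C.r i x) w

/-- The roots `β_j = s_{i_1} ⋯ s_{i_{j-1}} (α_{i_j})` of a word based at `x` (0-indexed). -/
def wordRoot (C : CartanScheme n) (x : C.X) (w : List (Fin n)) (j : Fin w.length) :
    Fin n → ℤ :=
  wordMap C x (w.take j) (alphav n (w.get j))

/-- A root system of type `𝒞`. -/
structure RootSystem (C : CartanScheme n) where
  Δ : C.X → Set (Fin n → ℤ)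
  pos_neg : ∀ x, Δ x = (Δ x ∩ Epos n) ∪ (-(Δ x ∩ Epos n))
  simple : ∀ x i, Δ x ∩ {v | ∃ m : ℤ, v = m • alphav n i} = {alphav n i, -alphav n i}
  s_invariant : ∀ x i, sMap C i x '' Δ x = Δ (C.r i x)
  rank_two_finite : ∀ x i j, i ≠ j →
    (Δ x ∩ {v | ∃ a b : ℕ, v = (a : ℤ) • alphav n i + (b : ℤ) • alphav n j}).Finite
  rank_two : ∀ x i j, i ≠ j →
    ((C.r i) ∘ (C.r j))^[(Δ x ∩
      {v | ∃ a b : ℕ, v = (a : ℤ) • alphav n i + (b : ℤ) • alphav n j}).ncard] x = x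

/-- Positive roots at `x`. -/
def RootSystem.pos {C : CartanScheme n} (R : RootSystem C) (x : C.X) : Set (Fin n → ℤ) :=
  R.Δ x ∩ Epos n

/-- `(φ, (y, x))` is realized by the word `w` based at `x` with endpoint `y`. -/
def IsWord (C : CartanScheme n) (x y : C.X) (φ : (Fin n → ℤ) → (Fin n → ℤ))
    (w : List (Fin n)) : Prop :=
  wordEnd C x w = y ∧ wordMap C x w = φ

/-- `(φ, (y, x))` is a morphism of the Weyl groupoid, i.e. `Hom(y, x) ∋ φ`. -/
def IsHom (C : CartanScheme n) (x y : C.X) (φ : (Fin n → ℤ) → (Fin n → ℤ)) : Prop :=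
  ∃ w : List (Fin n), IsWord C x y φ w

/-- The length `ℓ(w)` of a morphism. -/
def hlen (C : CartanScheme n) (x y : C.X) (φ : (Fin n → ℤ) → (Fin n → ℤ)) : ℕ :=
  sInf {m | ∃ w : List (Fin n), w.length = m ∧ IsWord C x y φ w}

/-- `w` is a reduced expression of the morphism `(φ, (y, x))`. -/
def IsReduced (C : CartanScheme n) (x y : C.X) (φ : (Fin n → ℤ) → (Fin n → ℤ))
    (w : List (Fin n)) : Prop :=
  IsWord C x y φ w ∧ w.length = hlen C x y φ

/-- `R_w = {α ∈ Δ^X_+ : w^{-1}(α) ∈ Δ^Y_-}`, phrased as `α = w(δ)` for a negative root `δ`. -/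
def Rset (C : CartanScheme n) (R : RootSystem C) (x y : C.X)
    (φ : (Fin n → ℤ) → (Fin n → ℤ)) : Set (Fin n → ℤ) :=
  {α | α ∈ R.pos x ∧ ∃ γ ∈ R.pos y, φ (-γ) = α}

end WeylGpd

namespace WeylGpd

section

variable {n : ℕ} {C : CartanScheme n}

/-! ### Linearity and invertibility of the reflections -/

lemma sMap_add (i : Fin n) (x : C.X) (u v : Fin n → ℤ) :
    sMap C i x (u + v) = sMap C i x u + sMap C i x v := by
  simp only [sMap, Pi.add_apply, mul_add, Finset.sum_add_distrib, add_smul]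
  abel

lemma sMap_smul (i : Fin n) (x : C.X) (c : ℤ) (v : Fin n → ℤ) :
    sMap C i x (c • v) = c • sMap C i x v := by
  simp only [sMap, Pi.smul_apply, smul_eq_mul, smul_sub, smul_smul, Finset.mul_sum]
  congr 2
  exact Finset.sum_congr rfl fun j _ => by ring

lemma sMap_alphav (i : Fin n) (x : C.X) : sMap C i x (alphav n i) = -alphav n i := by
  have h : ∑ j, C.A x i j * alphav n i j = 2 := by
    simp [alphav, Pi.single_apply, C.A_diag]
  rw [sMap, h]
  module

lemma sMap_sMap (i : Fin n) (x : C.X) (v : Fin n → ℤ) :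
    sMap C i x (sMap C i x v) = v := by
  conv_lhs => rw [sMap.eq_def C i x v]
  rw [sub_eq_add_neg, ← neg_smul, sMap_add, sMap_smul, sMap_alphav, sMap]
  module

lemma sMap_r (i : Fin n) (x : C.X) : sMap C i (C.r i x) = sMap C i x := by
  ext v
  simp [sMap, C.A_r]

lemma sMap_apply_of_ne {i l : Fin n} (h : l ≠ i) (x : C.X) (v : Fin n → ℤ) :
    sMap C i x v l = v l := by
  simp [sMap, alphav, h]

/-! ### Words -/

lemma wordMap_add (w : List (Fin n)) (x : C.X) (u v : Fin n → ℤ) :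
    wordMap C x w (u + v) = wordMap C x w u + wordMap C x w v := by
  induction w generalizing x with
  | nil => rfl
  | cons i w ih => simp [wordMap, ih, sMap_add]

lemma wordMap_smul (w : List (Fin n)) (x : C.X) (c : ℤ) (v : Fin n → ℤ) :
    wordMap C x w (c • v) = c • wordMap C x w v := by
  induction w generalizing x with
  | nil => rfl
  | cons i w ih => simp only [wordMap, Function.comp_apply, ih, sMap_smul]

lemma wordMap_neg (w : List (Fin n)) (x : C.X) (v : Fin n → ℤ) :
    wordMap C x w (-v) = -wordMap C x w v := by
  simpa using wordMap_smul w x (-1) v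

lemma wordEnd_append (u v : List (Fin n)) (x : C.X) :
    wordEnd C x (u ++ v) = wordEnd C (wordEnd C x u) v := by
  induction u generalizing x with
  | nil => rfl
  | cons i u ih => simp [wordEnd, ih]

lemma wordMap_append (u v : List (Fin n)) (x : C.X) (t : Fin n → ℤ) :
    wordMap C x (u ++ v) t = wordMap C x u (wordMap C (wordEnd C x u) v t) := by
  induction u generalizing x with
  | nil => rfl
  | cons i u ih => simp [wordMap, wordEnd, ih]

lemma wordEnd_concat (u : List (Fin n)) (i : Fin n) (x : C.X) :
    wordEnd C x (u ++ [i]) = C.r i (wordEnd C x u) := by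
  rw [wordEnd_append]; rfl

lemma wordMap_concat (u : List (Fin n)) (i : Fin n) (x : C.X) (t : Fin n → ℤ) :
    wordMap C x (u ++ [i]) t = wordMap C x u (sMap C i (wordEnd C x u) t) := by
  rw [wordMap_append]; rfl

lemma wordMap_concat_alphav (u : List (Fin n)) (i : Fin n) (x : C.X) :
    wordMap C x (u ++ [i]) (alphav n i) = -wordMap C x u (alphav n i) := by
  rw [wordMap_concat, sMap_alphav, wordMap_neg]

/-- Two words based at `x` represent the same morphism. -/
def WordEquiv (C : CartanScheme n) (x : C.X) (u v : List (Fin n)) : Prop :=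
  wordEnd C x u = wordEnd C x v ∧ wordMap C x u = wordMap C x v

namespace WordEquiv

lemma refl (x : C.X) (u : List (Fin n)) : WordEquiv C x u u := ⟨rfl, rfl⟩

lemma symm {x : C.X} {u v : List (Fin n)} (h : WordEquiv C x u v) : WordEquiv C x v u :=
  ⟨h.1.symm, h.2.symm⟩

lemma trans {x : C.X} {u v w : List (Fin n)} (h : WordEquiv C x u v) (h' : WordEquiv C x v w) :
    WordEquiv C x u w :=
  ⟨h.1.trans h'.1, h.2.trans h'.2⟩

lemma append_right {x : C.X} {u v : List (Fin n)} (h : WordEquiv C x u v) (w : List (Fin n)) :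
    WordEquiv C x (u ++ w) (v ++ w) := by
  refine ⟨by rw [wordEnd_append, wordEnd_append, h.1], ?_⟩
  ext1 t
  rw [wordMap_append, wordMap_append, h.1, h.2]

lemma append_left {x : C.X} {u v w : List (Fin n)} (h : WordEquiv C (wordEnd C x w) u v) :
    WordEquiv C x (w ++ u) (w ++ v) := by
  refine ⟨by rw [wordEnd_append, wordEnd_append, h.1], ?_⟩
  ext1 t
  rw [wordMap_append, wordMap_append, h.2]

end WordEquiv

lemma wordEquiv_letter_letter (x : C.X) (i : Fin n) : WordEquiv C x [i, i] [] := by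
  refine ⟨C.r_invol i x, ?_⟩
  ext1 t
  simp [wordMap, sMap_r, sMap_sMap]

lemma wordEquiv_append_reverse (x : C.X) (w : List (Fin n)) :
    WordEquiv C x (w ++ w.reverse) [] := by
  induction w using List.reverseRecOn generalizing x with
  | nil => exact .refl _ _
  | append_singleton w i ih =>
    have h : WordEquiv C (wordEnd C x w) ([i, i] ++ w.reverse) ([] ++ w.reverse) :=
      (wordEquiv_letter_letter _ i).append_right _
    have h' := (h.append_left (w := w)).trans (ih x)
    simpa using h'

lemma wordEquiv_reverse_append (x : C.X) (w : List (Fin n)) :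
    WordEquiv C x (w.reverse ++ w) [] := by
  simpa using wordEquiv_append_reverse x w.reverse

lemma wordEnd_reverse (x : C.X) (w : List (Fin n)) :
    wordEnd C (wordEnd C x w) w.reverse = x := by
  rw [← wordEnd_append]; exact (wordEquiv_append_reverse x w).1

lemma wordMap_wordMap_reverse (x : C.X) (w : List (Fin n)) (v : Fin n → ℤ) :
    wordMap C x w (wordMap C (wordEnd C x w) w.reverse v) = v := by
  rw [← wordMap_append, (wordEquiv_append_reverse x w).2]; rfl

lemma wordMap_reverse_wordMap (x : C.X) (w : List (Fin n)) (v : Fin n → ℤ) :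
    wordMap C (wordEnd C x w) w.reverse (wordMap C x w v) = v := by
  have h := wordMap_wordMap_reverse (wordEnd C x w) w.reverse v
  rwa [List.reverse_reverse, wordEnd_reverse] at h

lemma wordEquiv_of_append_reverse {x : C.X} {a b : List (Fin n)}
    (h : WordEquiv C x (a ++ b.reverse) []) : WordEquiv C x a b := by
  have h1 : WordEquiv C x (a ++ (b.reverse ++ b)) (a ++ []) :=
    (wordEquiv_reverse_append _ b).append_left
  rw [List.append_nil, ← List.append_assoc] at h1
  exact h1.symm.trans (h.append_right b)

lemma wordMap_apply_of_forall_ne {l : Fin n} {w : List (Fin n)} (h : ∀ i ∈ w, l ≠ i) (x : C.X)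
    (v : Fin n → ℤ) : wordMap C x w v l = v l := by
  induction w generalizing x with
  | nil => rfl
  | cons i w ih =>
    simp only [List.mem_cons, forall_eq_or_imp] at h
    simp [wordMap, sMap_apply_of_ne h.1, ih h.2]

/-! ### Positive and negative roots -/

lemma alphav_mem_Epos (i : Fin n) : alphav n i ∈ Epos n := fun l => by
  by_cases h : l = i <;> simp [alphav, h]

lemma add_mem_Epos {u v : Fin n → ℤ} (hu : u ∈ Epos n) (hv : v ∈ Epos n) : u + v ∈ Epos n :=
  fun i => add_nonneg (hu i) (hv i)

lemma smul_mem_Epos {c : ℤ} (hc : 0 ≤ c) {v : Fin n → ℤ} (hv : v ∈ Epos n) : c • v ∈ Epos n :=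
  fun i => mul_nonneg hc (hv i)

lemma eq_zero_of_mem_Epos {v : Fin n → ℤ} (h : v ∈ Epos n) (h' : -v ∈ Epos n) : v = 0 := by
  ext i
  have h1 := h i
  have h2 := h' i
  simp only [Pi.neg_apply] at h2
  simp only [Pi.zero_apply]
  omega

lemma alphav_ne_zero (i : Fin n) : alphav n i ≠ 0 := fun h => by
  simpa [alphav] using congrFun h i

variable (R : RootSystem C)

lemma RootSystem.alphav_mem (x : C.X) (i : Fin n) : alphav n i ∈ R.Δ x :=
  ((R.simple x i).symm ▸ Set.mem_insert _ _ :
    alphav n i ∈ R.Δ x ∩ {v | ∃ m : ℤ, v = m • alphav n i}).1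

lemma RootSystem.alphav_mem_pos (x : C.X) (i : Fin n) : alphav n i ∈ R.pos x :=
  ⟨R.alphav_mem x i, alphav_mem_Epos i⟩

lemma RootSystem.neg_mem {x : C.X} {v : Fin n → ℤ} (h : v ∈ R.Δ x) : -v ∈ R.Δ x := by
  have h' := h
  rw [R.pos_neg x] at h'
  rcases h' with h' | h'
  · rw [R.pos_neg x]
    exact Or.inr (by simpa using h')
  · exact h'.1

lemma RootSystem.neg_mem_pos {x : C.X} {v : Fin n → ℤ} (h : v ∈ R.Δ x) (h' : v ∉ Epos n) :
    -v ∈ R.pos x := by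
  rw [R.pos_neg x] at h
  rcases h with h | h
  · exact absurd h.2 h'
  · exact h

lemma RootSystem.ne_zero (hn : 1 ≤ n) {x : C.X} {v : Fin n → ℤ} (h : v ∈ R.Δ x) : v ≠ 0 := by
  rintro rfl
  have h0 : (0 : Fin n → ℤ) ∈ R.Δ x ∩ {v | ∃ m : ℤ, v = m • alphav n ⟨0, hn⟩} :=
    ⟨h, 0, by simp⟩
  rw [R.simple] at h0
  rcases h0 with h0 | h0
  · exact alphav_ne_zero _ h0.symm
  · exact alphav_ne_zero _ (by simpa using h0)

lemma RootSystem.neg_notMem_Epos (hn : 1 ≤ n) {x : C.X} {v : Fin n → ℤ} (h : v ∈ R.pos x) :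
    -v ∉ Epos n :=
  fun h' => R.ne_zero hn h.1 (eq_zero_of_mem_Epos h.2 h')

lemma RootSystem.sMap_mem {x : C.X} {i : Fin n} {v : Fin n → ℤ} (h : v ∈ R.Δ (C.r i x)) :
    sMap C i x v ∈ R.Δ x := by
  rw [← R.s_invariant] at h
  obtain ⟨u, hu, rfl⟩ := h
  rwa [sMap_sMap]

lemma RootSystem.wordMap_mem {x : C.X} {w : List (Fin n)} {v : Fin n → ℤ}
    (h : v ∈ R.Δ (wordEnd C x w)) : wordMap C x w v ∈ R.Δ x := by
  induction w generalizing x with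
  | nil => exact h
  | cons i w ih => exact R.sMap_mem (ih h)

lemma RootSystem.wordMap_reverse_mem {x : C.X} {w : List (Fin n)} {v : Fin n → ℤ}
    (h : v ∈ R.Δ x) : wordMap C (wordEnd C x w) w.reverse v ∈ R.Δ (wordEnd C x w) :=
  R.wordMap_mem (by rwa [wordEnd_reverse])

lemma RootSystem.eq_alphav {x : C.X} {v : Fin n → ℤ} {i : Fin n} (h : v ∈ R.pos x)
    (h' : ∀ l, l ≠ i → v l = 0) : v = alphav n i := by
  have h0 : v ∈ R.Δ x ∩ {v | ∃ m : ℤ, v = m • alphav n i} := by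
    refine ⟨h.1, v i, ?_⟩
    ext l
    by_cases hl : l = i
    · subst hl; simp [alphav]
    · simp [alphav, hl, h' l hl]
  rw [R.simple] at h0
  rcases h0 with h0 | h0
  · exact h0
  · have := h.2 i
    simp [Set.mem_singleton_iff.1 h0, alphav] at this

lemma RootSystem.sMap_mem_pos {x : C.X} {i : Fin n} {v : Fin n → ℤ}
    (h : v ∈ R.pos (C.r i x)) (hv : v ≠ alphav n i) : sMap C i x v ∈ R.pos x := by
  refine ⟨R.sMap_mem h.1, ?_⟩
  by_contra hneg
  have h1 := (R.neg_mem_pos (R.sMap_mem h.1) hneg).2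
  refine hv (R.eq_alphav h fun l hl => ?_)
  have h2 := h1 l
  have h3 := h.2 l
  rw [Pi.neg_apply, sMap_apply_of_ne hl] at h2
  omega

/-! ### Inversion sets -/

lemma mem_Rset_wordMap {x : C.X} {w : List (Fin n)} {α : Fin n → ℤ} :
    α ∈ Rset C R x (wordEnd C x w) (wordMap C x w) ↔
      α ∈ R.pos x ∧ -wordMap C (wordEnd C x w) w.reverse α ∈ R.pos (wordEnd C x w) := by
  constructor
  · rintro ⟨h, γ, hγ, rfl⟩
    exact ⟨h, by simpa [wordMap_neg, wordMap_reverse_wordMap] using hγ⟩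
  · rintro ⟨h, hγ⟩
    exact ⟨h, _, hγ, by simp [wordMap_wordMap_reverse]⟩

lemma Rset_concat (hn : 1 ≤ n) {x : C.X} {w : List (Fin n)} {i : Fin n}
    (h : wordMap C x w (alphav n i) ∈ Epos n) :
    wordMap C x w (alphav n i) ∉ Rset C R x (wordEnd C x w) (wordMap C x w) ∧
    Rset C R x (wordEnd C x (w ++ [i])) (wordMap C x (w ++ [i])) =
      insert (wordMap C x w (alphav n i)) (Rset C R x (wordEnd C x w) (wordMap C x w)) := by
  constructor
  · rw [mem_Rset_wordMap, wordMap_reverse_wordMap]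
    exact fun h' => R.neg_notMem_Epos hn (R.alphav_mem_pos x i) h'.2.2
  · ext α
    constructor
    · rintro ⟨hα, γ, hγ, rfl⟩
      rw [wordEnd_concat] at hγ
      rw [wordMap_concat] at hα ⊢
      by_cases hi : γ = alphav n i
      · subst hi
        left
        rw [← neg_one_smul ℤ (alphav n i), sMap_smul, sMap_alphav]
        simp
      · right
        refine ⟨hα, _, R.sMap_mem_pos hγ hi, ?_⟩
        rw [← neg_one_smul ℤ γ, sMap_smul, neg_one_smul]
    · rintro (rfl | ⟨hα, γ, hγ, rfl⟩)
      · refine ⟨⟨R.wordMap_mem (R.alphav_mem _ _), h⟩, alphav n i, R.alphav_mem_pos _ _, ?_⟩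
        rw [wordMap_neg, wordMap_concat_alphav, neg_neg]
      · have hi : γ ≠ alphav n i := by
          rintro rfl
          rw [wordMap_neg] at hα
          exact R.neg_notMem_Epos hn hα (by simpa using h)
        rw [← C.r_invol i (wordEnd C x w)] at hγ
        have := R.sMap_mem_pos hγ hi
        refine ⟨hα, _, wordEnd_concat w i x ▸ this, ?_⟩
        rw [wordMap_neg, wordMap_concat, wordEnd_concat, sMap_r, sMap_sMap, wordMap_neg]

/-- All roots `β_j` of the word are nonnegative. -/
def WordPositive (C : CartanScheme n) (x : C.X) (w : List (Fin n)) : Prop :=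
  ∀ u i v, w = u ++ i :: v → wordMap C x u (alphav n i) ∈ Epos n

lemma WordPositive.of_append {x : C.X} {u v : List (Fin n)} (h : WordPositive C x (u ++ v)) :
    WordPositive C x u :=
  fun u' i v' e => h u' i (v' ++ v) (by simp [e])

lemma WordPositive.nil (x : C.X) : WordPositive C x [] := fun u i v e => by simp at e

lemma wordPositive_concat {x : C.X} {u : List (Fin n)} {i : Fin n} :
    WordPositive C x (u ++ [i]) ↔
      WordPositive C x u ∧ wordMap C x u (alphav n i) ∈ Epos n := by
  refine ⟨fun h => ⟨h.of_append, h u i [] rfl⟩, fun h u' i' v e => ?_⟩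
  induction v using List.reverseRecOn with
  | nil =>
    obtain ⟨rfl, h1⟩ := List.append_inj' e rfl
    obtain rfl : i = i' := by simpa using h1
    exact h.2
  | append_singleton v j _ =>
    rw [← List.cons_append, ← List.append_assoc] at e
    exact h.1 _ _ _ (List.append_inj' e rfl).1

lemma Rset_nil (hn : 1 ≤ n) (x : C.X) :
    Rset C R x (wordEnd C x []) (wordMap C x []) = ∅ := by
  ext α
  simp only [Set.mem_empty_iff_false, iff_false]
  rintro ⟨h, γ, hγ, rfl⟩
  exact R.neg_notMem_Epos hn hγ h.2

lemma Rset_congr {x : C.X} {u v : List (Fin n)} (h : WordEquiv C x u v) :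
    Rset C R x (wordEnd C x u) (wordMap C x u) = Rset C R x (wordEnd C x v) (wordMap C x v) := by
  rw [h.1, h.2]

lemma Rset_insert_of_neg (hn : 1 ≤ n) {x : C.X} {w : List (Fin n)} {i : Fin n}
    (h : -wordMap C x w (alphav n i) ∈ Epos n) :
    -wordMap C x w (alphav n i) ∉
      Rset C R x (wordEnd C x (w ++ [i])) (wordMap C x (w ++ [i])) ∧
    Rset C R x (wordEnd C x w) (wordMap C x w) =
      insert (-wordMap C x w (alphav n i))
        (Rset C R x (wordEnd C x (w ++ [i])) (wordMap C x (w ++ [i]))) := by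
  rw [← wordMap_concat_alphav] at h ⊢
  have e : WordEquiv C x (w ++ [i] ++ [i]) w := by
    have := (wordEquiv_letter_letter (wordEnd C x w) i).append_left
    simpa using this
  have := Rset_concat R hn h
  rwa [Rset_congr R e] at this

lemma Rset_finite_and_ncard_le (hn : 1 ≤ n) (x : C.X) (w : List (Fin n)) :
    (Rset C R x (wordEnd C x w) (wordMap C x w)).Finite ∧
    (Rset C R x (wordEnd C x w) (wordMap C x w)).ncard ≤ w.length ∧
    ((Rset C R x (wordEnd C x w) (wordMap C x w)).ncard = w.length ↔ WordPositive C x w) := by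
  induction w using List.reverseRecOn with
  | nil => simp [Rset_nil R hn, WordPositive.nil]
  | append_singleton w i ih =>
    obtain ⟨hf, hle, hiff⟩ := ih
    rw [wordPositive_concat, List.length_append, List.length_singleton]
    by_cases h : wordMap C x w (alphav n i) ∈ Epos n
    · obtain ⟨h1, h2⟩ := Rset_concat R hn h
      rw [h2, Set.ncard_insert_of_notMem h1 hf]
      exact ⟨hf.insert _, by omega, by simp [h, hiff]⟩
    · obtain ⟨h1, h2⟩ := Rset_insert_of_neg R hn
        (R.neg_mem_pos (R.wordMap_mem (R.alphav_mem _ _)) h).2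
      have hf' := hf
      rw [h2] at hf' hle
      have hf'' := hf'.subset (Set.subset_insert _ _)
      rw [Set.ncard_insert_of_notMem h1 hf''] at hle
      refine ⟨hf'', by omega, ⟨fun h' => by omega, fun h' => absurd h'.2 h⟩⟩

lemma WordPositive.congr (R : RootSystem C) (hn : 1 ≤ n) {x : C.X} {u v : List (Fin n)}
    (h : WordPositive C x u) (e : WordEquiv C x u v) (hl : u.length = v.length) : WordPositive C x v := by
  rw [← (Rset_finite_and_ncard_le R hn x _).2.2] at h ⊢
  rw [← Rset_congr R e, h, hl]

/-! ### Rank two -/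

/-- The positive roots in the span of `α_p` and `α_q`. -/
def rankTwoPos {C : CartanScheme n} (R : RootSystem C) (x : C.X) (p q : Fin n) :
    Set (Fin n → ℤ) :=
  {v | v ∈ R.pos x ∧ ∀ l, l ≠ p → l ≠ q → v l = 0}

lemma rankTwoPos_comm (x : C.X) (p q : Fin n) : rankTwoPos R x p q = rankTwoPos R x q p := by
  ext v
  exact and_congr_right fun _ => forall_congr' fun l => ⟨fun h a b => h b a, fun h a b => h b a⟩

lemma eq_smul_add_smul {p q : Fin n} (hpq : p ≠ q) {v : Fin n → ℤ}
    (h : ∀ l, l ≠ p → l ≠ q → v l = 0) : v = v p • alphav n p + v q • alphav n q := by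
  ext l
  by_cases h1 : l = p
  · subst h1; simp [alphav, hpq]
  by_cases h2 : l = q
  · subst h2; simp [alphav, h1]
  simp [alphav, h1, h2, h l h1 h2]

lemma rankTwoPos_eq {p q : Fin n} (hpq : p ≠ q) (x : C.X) : rankTwoPos R x p q =
    R.Δ x ∩ {v | ∃ a b : ℕ, v = (a : ℤ) • alphav n p + (b : ℤ) • alphav n q} := by
  ext v
  constructor
  · rintro ⟨h, h'⟩
    refine ⟨h.1, (v p).toNat, (v q).toNat, ?_⟩
    rw [Int.toNat_of_nonneg (h.2 p), Int.toNat_of_nonneg (h.2 q)]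
    exact eq_smul_add_smul hpq h'
  · rintro ⟨h, a, b, rfl⟩
    refine ⟨⟨h, add_mem_Epos (smul_mem_Epos (by simp) (alphav_mem_Epos _))
      (smul_mem_Epos (by simp) (alphav_mem_Epos _))⟩, fun l h1 h2 => ?_⟩
    simp [alphav, h1, h2]

lemma rankTwoPos_finite {p q : Fin n} (hpq : p ≠ q) (x : C.X) : (rankTwoPos R x p q).Finite := by
  rw [rankTwoPos_eq R hpq]; exact R.rank_two_finite x p q hpq

lemma alphav_mem_rankTwoPos (x : C.X) (p q : Fin n) : alphav n p ∈ rankTwoPos R x p q :=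
  ⟨R.alphav_mem_pos x p, fun l h _ => by simp [alphav, h]⟩

lemma rankTwoPos_ncard_le {p q : Fin n} (hpq : p ≠ q) (x : C.X) :
    (rankTwoPos R (C.r p x) p q).ncard ≤ (rankTwoPos R x p q).ncard := by
  classical
  have key : ∀ v ∈ rankTwoPos R (C.r p x) p q, v ≠ alphav n p →
      sMap C p x v ∈ R.pos x ∧ sMap C p x v ≠ alphav n p := by
    refine fun v hv h => ⟨R.sMap_mem_pos hv.1 h, fun h' => ?_⟩
    have h2 : v = -alphav n p := by rw [← sMap_sMap p x v, h', sMap_alphav]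
    have := hv.1.2 p
    simp [h2, alphav] at this
  refine Set.ncard_le_ncard_of_injOn
    (fun v => if v = alphav n p then alphav n p else sMap C p x v) ?_ ?_ (rankTwoPos_finite R hpq x)
  · intro v hv
    by_cases h : v = alphav n p
    · simpa [h] using alphav_mem_rankTwoPos R x p q
    · simp only [h, if_false]
      exact ⟨(key v hv h).1, fun l h1 h2 => by rw [sMap_apply_of_ne h1, hv.2 l h1 h2]⟩
  · intro u hu v hv huv
    by_cases h : u = alphav n p <;> by_cases h' : v = alphav n p
    · rw [h, h']
    · simp only [h, h', if_true, if_false] at huv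
      exact absurd huv.symm (key v hv h').2
    · simp only [h, h', if_true, if_false] at huv
      exact absurd huv (key u hu h).2
    · simp only [h, h', if_false] at huv
      rw [← sMap_sMap p x u, huv, sMap_sMap]

lemma rankTwoPos_ncard_r {p q : Fin n} (hpq : p ≠ q) (x : C.X) :
    (rankTwoPos R (C.r p x) p q).ncard = (rankTwoPos R x p q).ncard := by
  refine le_antisymm (rankTwoPos_ncard_le R hpq x) ?_
  simpa [C.r_invol] using rankTwoPos_ncard_le R hpq (C.r p x)

lemma apply_eq_of_mem_pair {p q l : Fin n} {a : List (Fin n)} (ha : ∀ i ∈ a, i = p ∨ i = q)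
    (h1 : l ≠ p) (h2 : l ≠ q) (x : C.X) (v : Fin n → ℤ) : wordMap C x a v l = v l := by
  refine wordMap_apply_of_forall_ne (fun i hi => ?_) x v
  rcases ha i hi with rfl | rfl <;> assumption

lemma Rset_subset_rankTwoPos {p q : Fin n} {x : C.X} {a : List (Fin n)}
    (ha : ∀ i ∈ a, i = p ∨ i = q) :
    Rset C R x (wordEnd C x a) (wordMap C x a) ⊆ rankTwoPos R x p q := by
  rintro _ ⟨hα, γ, hγ, rfl⟩
  refine ⟨hα, fun l h1 h2 => ?_⟩
  have h3 := hα.2 l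
  rw [apply_eq_of_mem_pair ha h1 h2] at h3 ⊢
  have h4 := hγ.2 l
  simp only [Pi.neg_apply] at h3 ⊢
  omega

lemma wordMap_mem_Epos_of_pair {p q : Fin n} (hpq : p ≠ q) {x : C.X} {u : List (Fin n)}
    (hp : wordMap C x u (alphav n p) ∈ Epos n) (hq : wordMap C x u (alphav n q) ∈ Epos n)
    {v : Fin n → ℤ} (hv : v ∈ Epos n) (h : ∀ l, l ≠ p → l ≠ q → v l = 0) :
    wordMap C x u v ∈ Epos n := by
  rw [eq_smul_add_smul hpq h, wordMap_add, wordMap_smul, wordMap_smul]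
  exact add_mem_Epos (smul_mem_Epos (hv p) hp) (smul_mem_Epos (hv q) hq)

lemma neg_wordMap_mem_Epos_of_pair {p q : Fin n} (hpq : p ≠ q) {x : C.X} {u : List (Fin n)}
    (hp : -wordMap C x u (alphav n p) ∈ Epos n) (hq : -wordMap C x u (alphav n q) ∈ Epos n)
    {v : Fin n → ℤ} (hv : v ∈ Epos n) (h : ∀ l, l ≠ p → l ≠ q → v l = 0) :
    -wordMap C x u v ∈ Epos n := by
  rw [eq_smul_add_smul hpq h, wordMap_add, wordMap_smul, wordMap_smul, neg_add, ← smul_neg,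
    ← smul_neg]
  exact add_mem_Epos (smul_mem_Epos (hv p) hp) (smul_mem_Epos (hv q) hq)

/-- A word in `p, q` sending both simple roots to negative roots has maximal length. -/
lemma length_eq_ncard_of_neg (hn : 1 ≤ n) {p q : Fin n} (hpq : p ≠ q) {x : C.X}
    {a : List (Fin n)} (ha : ∀ i ∈ a, i = p ∨ i = q) (hg : WordPositive C x a)
    (hp : -wordMap C x a (alphav n p) ∈ Epos n) (hq : -wordMap C x a (alphav n q) ∈ Epos n) :
    a.length = (rankTwoPos R x p q).ncard := by
  rw [← (Rset_finite_and_ncard_le R hn x a).2.2.2 hg]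
  congr 1
  refine (Rset_subset_rankTwoPos R ha).antisymm fun α hα => ?_
  rw [mem_Rset_wordMap]
  refine ⟨hα.1, R.neg_mem_pos (R.wordMap_reverse_mem hα.1.1) fun hpos => ?_⟩
  refine R.neg_notMem_Epos hn hα.1 ?_
  have := neg_wordMap_mem_Epos_of_pair hpq hp hq hpos fun l h1 h2 => by
    rw [apply_eq_of_mem_pair (p := p) (q := q) (by simpa using ha) h1 h2, hα.2 l h1 h2]
  rwa [wordMap_wordMap_reverse] at this

/-- A word in `p, q` of maximal length sends all positive rank two roots to negative roots. -/
lemma neg_wordMap_mem_of_length_eq (hn : 1 ≤ n) {p q : Fin n} (hpq : p ≠ q) {x : C.X}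
    {a : List (Fin n)} (ha : ∀ i ∈ a, i = p ∨ i = q) (hg : WordPositive C x a)
    (hl : a.length = (rankTwoPos R x p q).ncard) {γ : Fin n → ℤ}
    (hγ : γ ∈ rankTwoPos R (wordEnd C x a) p q) :
    -wordMap C x a γ ∈ rankTwoPos R x p q := by
  have hmem := R.wordMap_mem hγ.1.1
  have h0 : ∀ l, l ≠ p → l ≠ q → wordMap C x a γ l = 0 := fun l h1 h2 => by
    rw [apply_eq_of_mem_pair ha h1 h2, hγ.2 l h1 h2]
  refine ⟨R.neg_mem_pos hmem fun hpos => ?_, fun l h1 h2 => by simp [h0 l h1 h2]⟩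
  have heq := Set.eq_of_subset_of_ncard_le (Rset_subset_rankTwoPos R (x := x) ha)
    (by rw [(Rset_finite_and_ncard_le R hn x a).2.2.2 hg, hl]) (rankTwoPos_finite R hpq x)
  have hin : wordMap C x a γ ∈ rankTwoPos R x p q := ⟨⟨hmem, hpos⟩, h0⟩
  rw [← heq, mem_Rset_wordMap, wordMap_reverse_wordMap] at hin
  exact R.neg_notMem_Epos hn hγ.1 hin.2.2

/-! ### Alternating words -/

/-- The alternating word `p, q, p, …` of a given length. -/
def altWord (p q : Fin n) : ℕ → List (Fin n)
  | 0 => []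
  | t + 1 => p :: altWord q p t

/-- The letter continuing `altWord p q t`. -/
def altNext (p q : Fin n) : ℕ → Fin n
  | 0 => p
  | t + 1 => altNext q p t

lemma altWord_length (p q : Fin n) (t : ℕ) : (altWord p q t).length = t := by
  induction t generalizing p q with
  | zero => rfl
  | succ t ih => simp [altWord, ih]

lemma mem_altWord {p q i : Fin n} {t : ℕ} (h : i ∈ altWord p q t) : i = p ∨ i = q := by
  induction t generalizing p q with
  | zero => simp [altWord] at h
  | succ t ih =>
    rcases List.mem_cons.1 h with h | h
    · exact Or.inl h
    · exact (ih h).symm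

lemma altWord_add (p q : Fin n) (t s : ℕ) :
    altWord p q (t + s) = altWord p q t ++ altWord (altNext p q t) (altNext q p t) s := by
  induction t generalizing p q with
  | zero => simp [altWord, altNext]
  | succ t ih => rw [Nat.succ_add]; simp [altWord, altNext, ih]

lemma altWord_succ (p q : Fin n) (t : ℕ) :
    altWord p q (t + 1) = altWord p q t ++ [altNext p q t] := by
  rw [altWord_add]; rfl

lemma altNext_pair (p q : Fin n) (t : ℕ) :
    altNext p q t = p ∧ altNext q p t = q ∨ altNext p q t = q ∧ altNext q p t = p := by
  induction t generalizing p q with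
  | zero => exact Or.inl ⟨rfl, rfl⟩
  | succ t ih => exact (ih q p).symm

lemma altNext_altNext (p q : Fin n) (t : ℕ) :
    altNext (altNext p q t) (altNext q p t) t = p := by
  rcases altNext_pair p q t with ⟨h, h'⟩ | ⟨h, h'⟩ <;> simp [h, h']

lemma altWord_two_mul_concat (p q : Fin n) (t : ℕ) :
    altWord p q (t + t) ++ [p] = p :: altWord q p (t + t) := by
  induction t with
  | zero => rfl
  | succ t ih =>
    rw [show t + 1 + (t + 1) = t + t + 1 + 1 by omega]
    simp only [altWord, List.cons_append, ih]

lemma altWord_append_reverse (p q : Fin n) (t : ℕ) :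
    altWord p q t ++ (altWord q p t).reverse = altWord p q (t + t) := by
  induction t generalizing p q with
  | zero => rfl
  | succ t ih =>
    rw [show t + 1 + (t + 1) = t + t + 1 + 1 by omega]
    simp only [altWord, List.reverse_cons, List.cons_append, ← List.append_assoc, ih,
      altWord_two_mul_concat]

lemma wordEnd_altWord (p q : Fin n) (t : ℕ) (x : C.X) :
    wordEnd C x (altWord p q (t + t)) = (C.r q ∘ C.r p)^[t] x := by
  induction t generalizing x with
  | zero => rfl
  | succ t ih =>
    rw [show t + 1 + (t + 1) = t + t + 1 + 1 by omega]
    simp only [altWord, wordEnd, ih, Function.iterate_succ, Function.comp_apply]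

lemma wordPositive_altWord (hn : 1 ≤ n) {p q : Fin n} (hpq : p ≠ q) (x : C.X) {t : ℕ}
    (ht : t ≤ (rankTwoPos R x p q).ncard) : WordPositive C x (altWord p q t) := by
  induction t with
  | zero => exact .nil x
  | succ t ih =>
    have ih := ih (by omega)
    rw [altWord_succ, wordPositive_concat]
    refine ⟨ih, ?_⟩
    cases t with
    | zero => exact alphav_mem_Epos _
    | succ s =>
      by_contra hneg
      have h1 := (R.neg_mem_pos (R.wordMap_mem (R.alphav_mem _ _)) hneg).2
      have h2 : -wordMap C x (altWord p q (s + 1)) (alphav n (altNext p q s)) ∈ Epos n := by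
        rw [altWord_succ, wordPositive_concat] at ih
        rw [altWord_succ, wordMap_concat_alphav, neg_neg]
        exact ih.2
      have h3 : -wordMap C x (altWord p q (s + 1)) (alphav n p) ∈ Epos n ∧
          -wordMap C x (altWord p q (s + 1)) (alphav n q) ∈ Epos n := by
        rcases altNext_pair p q s with ⟨h, h'⟩ | ⟨h, h'⟩
        · simp only [altNext, h, h'] at h1 h2; exact ⟨h2, h1⟩
        · simp only [altNext, h, h'] at h1 h2; exact ⟨h1, h2⟩
      have := length_eq_ncard_of_neg R hn hpq (fun i hi => mem_altWord hi) ih h3.1 h3.2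
      rw [altWord_length] at this
      omega

lemma wordPositive_eq_altWord (R : RootSystem C) {p q : Fin n} (hn : 1 ≤ n) {x : C.X}
    {a : List (Fin n)} (ha : ∀ i ∈ a, i = p ∨ i = q) (hg : WordPositive C x a) :
    a = altWord p q a.length ∨ a = altWord q p a.length := by
  induction a using List.reverseRecOn with
  | nil => exact Or.inl rfl
  | append_singleton a i ih =>
    have ih := ih (fun j hj => ha j (by simp [hj])) hg.of_append
    have hi := ha i (by simp)
    rw [List.length_append, List.length_singleton]
    rw [wordPositive_concat] at hg
    have key : ∀ p q : Fin n, (i = p ∨ i = q) → a = altWord p q a.length → a ≠ [] →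
        a ++ [i] = altWord p q (a.length + 1) := by
      intro p q hi h hne
      obtain ⟨s, hs⟩ := Nat.exists_eq_succ_of_ne_zero (mt List.length_eq_zero_iff.1 hne)
      rw [altWord_succ, ← h, hs, Nat.succ_eq_add_one, altNext]
      have hne' : i ≠ altNext p q s := by
        rintro rfl
        rw [hs, Nat.succ_eq_add_one, altWord_succ] at h
        rw [h, wordMap_concat_alphav, wordPositive_concat] at hg
        have := R.neg_notMem_Epos hn (x := x) ⟨R.wordMap_mem (R.alphav_mem _ _), hg.1.2⟩
        exact this hg.2
      congr 2
      rcases altNext_pair p q s with ⟨h1, h2⟩ | ⟨h1, h2⟩ <;> rw [h1] at hne' <;> rw [h2]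
      · exact hi.resolve_left hne'
      · exact hi.resolve_right hne'
    by_cases hne : a = []
    · subst hne
      rcases hi with rfl | rfl
      · exact Or.inl rfl
      · exact Or.inr rfl
    · exact ih.imp (fun h => key p q hi h hne) (fun h => key q p hi.symm h hne)

lemma ncard_rankTwoPos_wordEnd {p q : Fin n} (hpq : p ≠ q) {a : List (Fin n)}
    (ha : ∀ i ∈ a, i = p ∨ i = q) (x : C.X) :
    (rankTwoPos R (wordEnd C x a) p q).ncard = (rankTwoPos R x p q).ncard := by
  induction a generalizing x with
  | nil => rfl
  | cons i a ih =>
    rw [wordEnd, ih (fun j hj => ha j (by simp [hj]))]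
    rcases ha i (by simp) with rfl | rfl
    · exact rankTwoPos_ncard_r R hpq x
    · rw [rankTwoPos_comm, rankTwoPos_comm R x]
      exact rankTwoPos_ncard_r R hpq.symm x

/-- The longest alternating word sends the simple root of its continuing letter to the negative
of the simple root of its first letter. -/
lemma wordMap_altWord_altNext (hn : 1 ≤ n) {p q : Fin n} (hpq : p ≠ q) (x : C.X) {m : ℕ}
    (hm : m = (rankTwoPos R x p q).ncard) :
    wordMap C x (altWord p q m) (alphav n (altNext p q m)) = -alphav n p := by
  obtain _ | t := m
  · have := (Set.ncard_eq_zero (rankTwoPos_finite R hpq x)).1 hm.symm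
    exact absurd (alphav_mem_rankTwoPos R x p q) (this ▸ Set.notMem_empty _)
  have hg : WordPositive C (C.r p x) (altWord q p (t + 1)) :=
    wordPositive_altWord R hn hpq.symm _ (by rw [rankTwoPos_comm, rankTwoPos_ncard_r R hpq, hm])
  rw [altWord_succ, wordPositive_concat] at hg
  have hneg := (neg_wordMap_mem_of_length_eq R hn hpq (fun i hi => mem_altWord hi)
    (wordPositive_altWord R hn hpq x hm.le) ((altWord_length _ _ _).trans hm)
    (γ := alphav n (altNext p q (t + 1))) (by
      rcases altNext_pair p q (t + 1) with ⟨h, h'⟩ | ⟨h, h'⟩ <;> rw [h]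
      · exact alphav_mem_rankTwoPos R _ p q
      · rw [rankTwoPos_comm]; exact alphav_mem_rankTwoPos R _ q p)).1
  simp only [altWord, wordMap, altNext, Function.comp_apply] at hneg ⊢
  have hβ : wordMap C (C.r p x) (altWord q p t) (alphav n (altNext q p t)) = alphav n p := by
    by_contra hne
    exact R.neg_notMem_Epos hn
      (R.sMap_mem_pos ⟨R.wordMap_mem (R.alphav_mem _ _), hg.2⟩ hne) hneg.2
  rw [hβ, sMap_alphav]

lemma wordMap_eq_sum (x : C.X) (w : List (Fin n)) (v : Fin n → ℤ) :
    wordMap C x w v = ∑ l, v l • wordMap C x w (alphav n l) := by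
  let f : (Fin n → ℤ) →ₗ[ℤ] (Fin n → ℤ) :=
    { toFun := wordMap C x w
      map_add' := wordMap_add w x
      map_smul' := wordMap_smul w x }
  have h := LinearMap.pi_apply_eq_sum_univ f v
  simp only [f, LinearMap.coe_mk, AddHom.coe_mk] at h
  rw [h]
  refine Finset.sum_congr rfl fun l _ => ?_
  congr 2
  ext k
  simp [alphav, Pi.single_apply, eq_comm]

/-- The closed alternating word of twice the maximal length is trivial. -/
lemma wordEquiv_altWord_nil (hn : 1 ≤ n) {p q : Fin n} (hpq : p ≠ q) (x : C.X) {m : ℕ}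
    (hm : m = (rankTwoPos R x p q).ncard) : WordEquiv C x (altWord p q (m + m)) [] := by
  have hend : wordEnd C x (altWord p q (m + m)) = x := by
    rw [wordEnd_altWord, hm, rankTwoPos_comm, rankTwoPos_eq R hpq.symm]
    exact R.rank_two x q p hpq.symm
  refine ⟨hend, ?_⟩
  have hletters : ∀ i ∈ altWord p q (m + m), i = p ∨ i = q := fun i hi => mem_altWord hi
  have hrev : ∀ i ∈ (altWord p q (m + m)).reverse, i = p ∨ i = q := by simpa using hletters
  have hsplit := altWord_add p q m m
  have hgood := wordPositive_altWord R hn hpq x hm.le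
  have ha : ∀ i ∈ altWord p q m, i = p ∨ i = q := fun i hi => mem_altWord hi
  have hcomm : ∀ y, rankTwoPos R y (altNext p q m) (altNext q p m) = rankTwoPos R y p q := by
    intro y
    rcases altNext_pair p q m with ⟨h, h'⟩ | ⟨h, h'⟩ <;> rw [h, h']
    exact rankTwoPos_comm R y q p
  have hne : altNext p q m ≠ altNext q p m := by
    rcases altNext_pair p q m with ⟨h, h'⟩ | ⟨h, h'⟩ <;> rw [h, h']
    exacts [hpq, hpq.symm]
  have hm' : m = (rankTwoPos R (wordEnd C x (altWord p q m)) (altNext p q m)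
      (altNext q p m)).ncard := by
    rw [hcomm, ncard_rankTwoPos_wordEnd R hpq ha, hm]
  have hgood' := wordPositive_altWord R hn hne _ hm'.le
  have hp : wordMap C x (altWord p q (m + m)) (alphav n p) = alphav n p := by
    have h := wordMap_altWord_altNext R hn hne _ hm'
    rw [altNext_altNext] at h
    rw [hsplit, wordMap_append, h, wordMap_neg, wordMap_altWord_altNext R hn hpq x hm, neg_neg]
  have hpos : ∀ γ ∈ rankTwoPos R x p q,
      wordMap C x (altWord p q (m + m)) γ ∈ rankTwoPos R x p q := by
    intro γ hγ
    rw [← hend, hsplit, wordEnd_append, ← hcomm] at hγ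
    have h1 := neg_wordMap_mem_of_length_eq R hn hne (fun i hi => mem_altWord hi) hgood'
      ((altWord_length _ _ _).trans hm') hγ
    rw [hcomm] at h1
    have h2 := neg_wordMap_mem_of_length_eq R hn hpq ha hgood ((altWord_length _ _ _).trans hm) h1
    rwa [wordMap_neg, neg_neg, ← wordMap_append, ← hsplit] at h2
  generalize altWord p q (m + m) = w at hend hletters hrev hp hpos
  have hinv := wordMap_reverse_wordMap x w
  have hinv' := wordMap_wordMap_reverse x w
  have hmem : ∀ v ∈ R.Δ x, wordMap C x w.reverse v ∈ R.Δ x := fun v hv => by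
    have := R.wordMap_reverse_mem (w := w) hv
    rwa [hend] at this
  rw [hend] at hinv hinv'
  have hpos' : ∀ γ ∈ rankTwoPos R x p q, wordMap C x w.reverse γ ∈ rankTwoPos R x p q := by
    intro γ hγ
    have h0 : ∀ l, l ≠ p → l ≠ q → wordMap C x w.reverse γ l = 0 := fun l h1 h2 => by
      rw [apply_eq_of_mem_pair hrev h1 h2, hγ.2 l h1 h2]
    refine ⟨⟨hmem γ hγ.1.1, ?_⟩, h0⟩
    by_contra hneg
    have := hpos _ ⟨R.neg_mem_pos (hmem γ hγ.1.1) hneg, fun l h1 h2 => by simp [h0 l h1 h2]⟩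
    rw [wordMap_neg, hinv'] at this
    exact R.neg_notMem_Epos hn hγ.1 this.1.2
  have hp' : wordMap C x w.reverse (alphav n p) = alphav n p := by
    conv_lhs => rw [← hp, hinv]
  have hq_mem : alphav n q ∈ rankTwoPos R x p q := by
    rw [rankTwoPos_comm]; exact alphav_mem_rankTwoPos R x q p
  have hq : wordMap C x w (alphav n q) = alphav n q := by
    have h1 := hpos _ hq_mem
    have h2 := hpos' _ hq_mem
    have e := hinv (alphav n q)
    have e1 := eq_smul_add_smul hpq h1.2
    have e2 := eq_smul_add_smul hpq h2.2
    have n1 := h1.1.2 p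
    have n2 := h1.1.2 q
    have n3 := h2.1.2 p
    have n4 := h2.1.2 q
    generalize wordMap C x w (alphav n q) p = a at *
    generalize wordMap C x w (alphav n q) q = b at *
    generalize wordMap C x w.reverse (alphav n q) p = c at *
    generalize wordMap C x w.reverse (alphav n q) q = d at *
    rw [e1, wordMap_add, wordMap_smul, wordMap_smul, hp', e2] at e
    have f1 := congrFun e p
    have f2 := congrFun e q
    simp [alphav, hpq, hpq.symm] at f1 f2
    have hb : b = 1 := Int.eq_one_of_mul_eq_one_right n2 f2
    subst hb
    have ha : a = 0 := by linarith
    rw [e1, ha]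
    simp
  have hq' : wordMap C x w.reverse (alphav n q) = alphav n q := by
    conv_lhs => rw [← hq, hinv]
  have hk : ∀ k, wordMap C x w (alphav n k) = alphav n k := by
    intro k
    by_cases h1 : k = p
    · rw [h1, hp]
    by_cases h2 : k = q
    · rw [h2, hq]
    have hE : ∀ v ∈ R.Δ x, v k = 1 → v ∈ Epos n := fun v hv hvk => by
      by_contra hneg
      have := (R.neg_mem_pos hv hneg).2 k
      simp [hvk] at this
    have hkk : alphav n k k = 1 := by simp [alphav]
    have i1 : wordMap C x w (alphav n k) ∈ Epos n :=
      hE _ (R.wordMap_mem (R.alphav_mem _ _))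
        (by rw [apply_eq_of_mem_pair hletters h1 h2, hkk])
    have i2 : wordMap C x w.reverse (alphav n k) ∈ Epos n :=
      hE _ (hmem _ (R.alphav_mem _ _)) (by rw [apply_eq_of_mem_pair hrev h1 h2, hkk])
    have e := hinv (alphav n k)
    have e1 := eq_smul_add_smul hpq (v := wordMap C x w (alphav n k) - alphav n k)
      fun l h3 h4 => by rw [Pi.sub_apply, apply_eq_of_mem_pair hletters h3 h4, sub_self]
    rw [sub_eq_iff_eq_add] at e1
    have n1 := i1 p
    have n2 := i1 q
    have n3 := i2 p
    have n4 := i2 q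
    have z1 : alphav n k p = 0 := by simp [alphav, Ne.symm h1]
    have z2 : alphav n k q = 0 := by simp [alphav, Ne.symm h2]
    simp only [Pi.sub_apply, z1, z2, sub_zero] at e1
    generalize wordMap C x w (alphav n k) p = a at *
    generalize wordMap C x w (alphav n k) q = b at *
    rw [e1, wordMap_add, wordMap_add, wordMap_smul, wordMap_smul, hp', hq'] at e
    have f1 := congrFun e p
    have f2 := congrFun e q
    simp only [Pi.add_apply, z1, z2] at f1 f2
    simp [alphav, hpq, hpq.symm] at f1 f2
    simp only [alphav] at n3 n4
    have ha : a = 0 := by linarith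
    have hb : b = 0 := by linarith
    rw [e1, ha, hb]
    simp
  ext1 v
  have h1 := wordMap_eq_sum x w v
  simp only [hk] at h1
  rw [h1]
  exact (wordMap_eq_sum x [] v).symm

lemma wordEquiv_altWord_comm (hn : 1 ≤ n) {p q : Fin n} (hpq : p ≠ q) (x : C.X) {m : ℕ}
    (hm : m = (rankTwoPos R x p q).ncard) : WordEquiv C x (altWord p q m) (altWord q p m) := by
  refine wordEquiv_of_append_reverse ?_
  rw [altWord_append_reverse]
  exact wordEquiv_altWord_nil R hn hpq x hm

/-! ### The exchange property -/

lemma exists_wordEquiv_pair (R : RootSystem C) {x : C.X} {u : List (Fin n)} {i j : Fin n}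
    (ih : ∀ v : List (Fin n), v.length < u.length → WordPositive C x v → ∀ k : Fin n,
      wordMap C x v (alphav n k) ∉ Epos n →
      ∃ v' : List (Fin n), v'.length + 1 = v.length ∧ WordEquiv C x (v' ++ [k]) v)
    (hn : 1 ≤ n) (v a : List (Fin n)) (hv : v.length < u.length) (hg : WordPositive C x v)
    (ha : ∀ k ∈ a, k = i ∨ k = j) (he : WordEquiv C x u (v ++ a))
    (hl : v.length + a.length = u.length) :
    ∃ v a : List (Fin n), wordMap C x v (alphav n i) ∈ Epos n ∧
      wordMap C x v (alphav n j) ∈ Epos n ∧ (∀ k ∈ a, k = i ∨ k = j) ∧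
      WordEquiv C x u (v ++ a) ∧ v.length + a.length = u.length := by
  induction hlen : v.length generalizing v a with
  | zero =>
    obtain rfl := List.length_eq_zero_iff.1 hlen
    exact ⟨[], a, alphav_mem_Epos _, alphav_mem_Epos _, ha, he, hl⟩
  | succ N IH =>
    have step : ∀ k, (k = i ∨ k = j) → wordMap C x v (alphav n k) ∉ Epos n →
        ∃ v a : List (Fin n), wordMap C x v (alphav n i) ∈ Epos n ∧
          wordMap C x v (alphav n j) ∈ Epos n ∧ (∀ k ∈ a, k = i ∨ k = j) ∧
          WordEquiv C x u (v ++ a) ∧ v.length + a.length = u.length := by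
      intro k hk hneg
      obtain ⟨v', hv', e⟩ := ih v hv hg k hneg
      have hg' : WordPositive C x (v' ++ [k]) := hg.congr R hn e.symm (by simp [hv'])
      refine IH v' (k :: a) (by omega) hg'.of_append ?_ ?_ ?_ (by omega)
      · simpa [hk] using ha
      · have := e.symm.append_right a
        rw [List.append_assoc] at this
        exact he.trans this
      · rw [List.length_cons]; omega
    by_cases h1 : wordMap C x v (alphav n i) ∈ Epos n
    · by_cases h2 : wordMap C x v (alphav n j) ∈ Epos n
      · exact ⟨v, a, h1, h2, ha, he, hl⟩
      · exact step j (Or.inr rfl) h2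
    · exact step i (Or.inl rfl) h1

/-- If all roots of `u` are positive but `u` sends `α_i` to a negative root, then `u` is
equivalent to a word of the same length ending in `i`. -/
lemma exists_wordEquiv_concat (R : RootSystem C) (hn : 1 ≤ n) (x : C.X) (u : List (Fin n))
    (hg : WordPositive C x u) (i : Fin n) (hneg : wordMap C x u (alphav n i) ∉ Epos n) :
    ∃ u' : List (Fin n), u'.length + 1 = u.length ∧ WordEquiv C x (u' ++ [i]) u := by
  induction hN : u.length using Nat.strong_induction_on generalizing u i with
  | _ N IH =>
  subst hN
  rcases List.eq_nil_or_concat' u with rfl | ⟨u₁, j, rfl⟩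
  · exact absurd (alphav_mem_Epos i) hneg
  by_cases hij : i = j
  · subst hij
    exact ⟨u₁, by simp, .refl _ _⟩
  have hg1 := wordPositive_concat.1 hg
  obtain ⟨v, a, hvi, hvj, ha, he, hl⟩ := exists_wordEquiv_pair R (i := i) (j := j)
    (fun v hv hgv k hk => IH v.length hv v hgv k hk rfl) hn u₁ [j]
    (by simp) hg1.1 (by simp) (.refl _ _) (by simp)
  have hne : ∀ {z : C.X} {α : Fin n → ℤ}, α ∈ R.Δ z → -α ∈ Epos n → α ∉ Epos n :=
    fun hα h1 h2 => R.neg_notMem_Epos hn ⟨hα, h2⟩ h1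
  have hva : WordPositive C x (v ++ a) := hg.congr R hn he (by simp [← hl])
  have hsupp : ∀ (b : List (Fin n)) (k : Fin n), (∀ l ∈ b, l = i ∨ l = j) → (k = i ∨ k = j) →
      ∀ l, l ≠ i → l ≠ j → wordMap C (wordEnd C x v) b (alphav n k) l = 0 := by
    intro b k hb hk l h1 h2
    rw [apply_eq_of_mem_pair hb h1 h2]
    rcases hk with rfl | rfl <;> simp [alphav, h1, h2]
  have haPos : WordPositive C (wordEnd C x v) a := by
    intro b k c hbc
    have hb : ∀ l ∈ b, l = i ∨ l = j := fun l hl => ha l (by simp [hbc, hl])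
    have hk : k = i ∨ k = j := ha k (by simp [hbc])
    by_contra hneg
    have h1 := (R.neg_mem_pos (R.wordMap_mem (R.alphav_mem _ _)) hneg).2
    have h2 := hva (v ++ b) k c (by simp [hbc])
    have h3 := wordMap_mem_Epos_of_pair hij hvi hvj h1 fun l hl1 hl2 => by
      simp [hsupp b k hb hk l hl1 hl2]
    rw [wordMap_neg, ← wordMap_append] at h3
    exact hne (R.wordMap_mem (R.alphav_mem _ _)) h3 h2
  have haNeg : ∀ k, (k = i ∨ k = j) → wordMap C x (u₁ ++ [j]) (alphav n k) ∉ Epos n →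
      -wordMap C (wordEnd C x v) a (alphav n k) ∈ Epos n := by
    intro k hk h
    refine (R.neg_mem_pos (R.wordMap_mem (R.alphav_mem _ _)) fun hpos => h ?_).2
    rw [he.2, wordMap_append]
    exact wordMap_mem_Epos_of_pair hij hvi hvj hpos (hsupp a k ha hk)
  have hj : wordMap C x (u₁ ++ [j]) (alphav n j) ∉ Epos n :=
    hne (R.wordMap_mem (R.alphav_mem _ _)) (by rw [wordMap_concat_alphav, neg_neg]; exact hg1.2)
  have hm := length_eq_ncard_of_neg R hn hij ha haPos (haNeg i (Or.inl rfl) hneg)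
    (haNeg j (Or.inr rfl) hj)
  have hcomm := wordEquiv_altWord_comm R hn hij _ hm
  have hb : WordEquiv C (wordEnd C x v) (altWord i j a.length) a ∧
      WordEquiv C (wordEnd C x v) (altWord j i a.length) a := by
    rcases wordPositive_eq_altWord R hn ha haPos with h | h
    · rw [← h] at hcomm ⊢; exact ⟨.refl _ _, hcomm.symm⟩
    · rw [← h] at hcomm ⊢; exact ⟨hcomm, .refl _ _⟩
  obtain ⟨s, hs⟩ : ∃ s, a.length = s + 1 := by
    refine Nat.exists_eq_succ_of_ne_zero fun h0 => ?_
    obtain rfl := List.length_eq_zero_iff.1 h0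
    exact hneg (by rw [he.2, List.append_nil]; exact hvi)
  obtain ⟨b, hbl, hbe⟩ : ∃ b : List (Fin n), b.length = s ∧
      WordEquiv C (wordEnd C x v) (b ++ [i]) a := by
    rw [hs, altWord_succ, altWord_succ] at hb
    rcases altNext_pair i j s with ⟨h, h'⟩ | ⟨h, h'⟩ <;> rw [h, h'] at hb
    · exact ⟨_, altWord_length _ _ _, hb.1⟩
    · exact ⟨_, altWord_length _ _ _, hb.2⟩
  refine ⟨v ++ b, by rw [List.length_append]; omega, ?_⟩
  have := hbe.append_left.trans he.symm
  rwa [← List.append_assoc] at this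

lemma wordPositive_of_isReduced (R : RootSystem C) (hn : 1 ≤ n) {x y : C.X}
    {φ : (Fin n → ℤ) → (Fin n → ℤ)} {w : List (Fin n)} (hw : IsReduced C x y φ w) :
    WordPositive C x w := by
  have key : ∀ u v, w = u ++ v → WordPositive C x u := by
    intro u
    induction u using List.reverseRecOn with
    | nil => exact fun _ _ => .nil x
    | append_singleton u i ih =>
      intro v hv
      have hg := ih ([i] ++ v) (by simpa using hv)
      rw [wordPositive_concat]
      refine ⟨hg, ?_⟩
      by_contra hneg
      obtain ⟨u', hl, e⟩ := exists_wordEquiv_concat R hn x u hg i hneg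
      have e1 : WordEquiv C x (u' ++ [i] ++ [i]) u' := by
        simpa using (wordEquiv_letter_letter (wordEnd C x u') i).append_left
      have e2 : WordEquiv C x (u' ++ v) w := by
        rw [hv]
        exact (e1.symm.trans (e.append_right [i])).append_right v
      have hle : hlen C x y φ ≤ (u' ++ v).length :=
        Nat.sInf_le ⟨_, rfl, e2.1.trans hw.1.1, e2.2.trans hw.1.2⟩
      rw [← hw.2, hv] at hle
      simp only [List.length_append, List.length_singleton] at hle
      omega
  exact key w [] (by simp)

lemma range_wordRoot_concat (x : C.X) (w : List (Fin n)) (i : Fin n) :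
    Set.range (wordRoot C x (w ++ [i])) =
      insert (wordMap C x w (alphav n i)) (Set.range (wordRoot C x w)) := by
  ext α
  constructor
  · rintro ⟨⟨j, hj⟩, rfl⟩
    by_cases h : j < w.length
    · refine Or.inr ⟨⟨j, h⟩, ?_⟩
      simp [wordRoot, List.take_append_of_le_length h.le, List.getElem_append_left h]
    · obtain rfl : j = w.length := by simp at hj; omega
      exact Or.inl (by simp [wordRoot])
  · rintro (rfl | ⟨⟨j, h⟩, rfl⟩)
    · exact ⟨⟨w.length, by simp⟩, by simp [wordRoot]⟩
    · refine ⟨⟨j, by simp; omega⟩, ?_⟩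
      simp [wordRoot, List.take_append_of_le_length h.le, List.getElem_append_left h]

lemma range_wordRoot (hn : 1 ≤ n) {x : C.X} {w : List (Fin n)} (h : WordPositive C x w) :
    Set.range (wordRoot C x w) = Rset C R x (wordEnd C x w) (wordMap C x w) := by
  induction w using List.reverseRecOn with
  | nil =>
    rw [Rset_nil R hn]
    exact Set.range_eq_empty_iff.2 ⟨fun j => j.elim0⟩
  | append_singleton w i ih =>
    rw [wordPositive_concat] at h
    rw [range_wordRoot_concat, ih h.1, (Rset_concat R hn h.2).2]

end

/-- For a reduced expression `(i_1, …, i_m)` of `w ∈ Hom(Y, X)`, the roots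
`β_1, …, β_m` are pairwise distinct positive roots, and `{β_1, …, β_m} = R_w`; consequently
`|R_w| = ℓ(w)` and the set `{β_1, …, β_m}` is independent of the reduced expression. -/
theorem stmt0 {n : ℕ} (hn : 1 ≤ n) (C : CartanScheme n) (R : RootSystem C)
    (x y : C.X) (φ : (Fin n → ℤ) → (Fin n → ℤ))
    (w : List (Fin n)) (hw : IsReduced C x y φ w) :
    (∀ j : Fin w.length, wordRoot C x w j ∈ R.pos x) ∧
    Function.Injective (wordRoot C x w) ∧
    Set.range (wordRoot C x w) = Rset C R x y φ ∧
    (Rset C R x y φ).ncard = hlen C x y φ := by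
  have hg := wordPositive_of_isReduced R hn hw
  obtain ⟨⟨rfl, rfl⟩, hlen⟩ := hw
  have hr := range_wordRoot R hn hg
  have hc := (Rset_finite_and_ncard_le R hn x w).2.2.2 hg
  refine ⟨fun j => ?_, ?_, hr, hc.trans hlen⟩
  · exact (hr ▸ Set.mem_range_self j :
      wordRoot C x w j ∈ Rset C R x (wordEnd C x w) (wordMap C x w)).1
  · rw [← Set.injOn_univ]
    refine Set.injOn_of_ncard_image_eq ?_ Set.finite_univ
    rw [Set.image_univ, hr, hc, Set.ncard_univ, Nat.card_eq_fintype_card, Fintype.card_fin]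

end WeylGpd
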